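/- arXiv:2107.01925 — 2 statements merged into one kernel-verified Lean document; each statement's English description precedes it below -/
import Mathlib

section
/- For all m, n ∈ ℕ with m ≠ n, the subgroups Hₘ and Hₙ are not conjugate in SL₂(k) × SL₂(k): there is no element x ∈ SL₂(k) × SL₂(k) such that x Hₘ x⁻¹ = Hₙ. -/
namespace Matrix.SpecialLinearGroup

theorem trace_iterate_map_frobenius {ι k : Type*} [Fintype ι] [DecidableEq ι] [CommRing k]
    (p : ℕ) [ExpChar k p] (n : ℕ) (g : SpecialLinearGroup ι k) :
    (((⇑(map (n := ι) (frobenius k p)))^[n] g : SpecialLinearGroup ι k) : Matrix ι ι k).trace =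
      (g : Matrix ι ι k).trace ^ p ^ n := by
  induction n with
  | zero => simp
  | succ n ih =>
    rw [Function.iterate_succ_apply', pow_succ, pow_mul, ← ih, ← frobenius_def,
      AddMonoidHom.map_trace]
    rfl

theorem trace_conj {ι k : Type*} [Fintype ι] [DecidableEq ι] [CommRing k]
    (x g : SpecialLinearGroup ι k) :
    ((x * g * x⁻¹ : SpecialLinearGroup ι k) : Matrix ι ι k).trace =
      (g : Matrix ι ι k).trace := by
  rw [coe_mul, Matrix.trace_mul_comm, ← coe_mul]
  simp

theorem exists_trace_eq {k : Type*} [CommRing k] (t : k) :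
    ∃ g : SpecialLinearGroup (Fin 2) k, (g : Matrix (Fin 2) (Fin 2) k).trace = t :=
  ⟨⟨!![t, -1; 1, 0], by simp [Matrix.det_fin_two]⟩, by simp [Matrix.trace_fin_two]⟩

end Matrix.SpecialLinearGroup

theorem eq_of_forall_pow_eq_pow {k : Type*} [CommRing k] [IsDomain k] [Infinite k] {a b : ℕ}
    (h : ∀ t : k, t ^ a = t ^ b) : a = b := by
  have hX : (Polynomial.X ^ a : Polynomial k) = Polynomial.X ^ b :=
    Polynomial.funext fun t => by simpa using h t
  simpa using congrArg Polynomial.natDegree hX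


/-- With `k` algebraically closed of characteristic `p > 0`,
`σ` the entrywise Frobenius on `SL₂(k)`, `φ n : g ↦ (g, σⁿ g)` and `H n = range (φ n)`,
the subgroups `H m` and `H n` are not conjugate in `SL₂(k) × SL₂(k)` for `m ≠ n`:
there is no `x` with `x (H m) x⁻¹ = H n`. -/
theorem stmt2 {k : Type*} [Field k] [IsAlgClosed k] {p : ℕ} [Fact p.Prime] [CharP k p]
    (φ : ℕ → (Matrix.SpecialLinearGroup (Fin 2) k →*
      Matrix.SpecialLinearGroup (Fin 2) k × Matrix.SpecialLinearGroup (Fin 2) k))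
    (hφ : ∀ n g, φ n g = (g, (⇑(Matrix.SpecialLinearGroup.map (n := Fin 2) (frobenius k p)))^[n] g))
    (H : ℕ → Subgroup (Matrix.SpecialLinearGroup (Fin 2) k × Matrix.SpecialLinearGroup (Fin 2) k))
    (hH : ∀ n, H n = (φ n).range) :
    ∀ m n : ℕ, m ≠ n →
      ¬ ∃ x : Matrix.SpecialLinearGroup (Fin 2) k × Matrix.SpecialLinearGroup (Fin 2) k,
        Subgroup.map (MulAut.conj x).toMonoidHom (H m) = H n := by
  rintro m n hmn ⟨x, hx⟩
  have hp : p.Prime := Fact.out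
  have : Infinite k := IsAlgClosed.instInfinite
  refine hmn (Nat.pow_right_injective hp.two_le (eq_of_forall_pow_eq_pow (k := k) fun t => ?_))
  obtain ⟨g, rfl⟩ := Matrix.SpecialLinearGroup.exists_trace_eq t
  have hg : MulAut.conj x (φ m g) ∈ H n := by
    rw [← hx, hH]
    exact Subgroup.mem_map_of_mem _ ⟨g, rfl⟩
  rw [hH] at hg
  obtain ⟨g', hg'⟩ := hg
  rw [hφ, hφ, MulAut.conj_apply, Prod.ext_iff] at hg'
  obtain ⟨h₁, h₂⟩ := hg'
  simp only [Prod.fst_mul, Prod.snd_mul, Prod.fst_inv, Prod.snd_inv] at h₁ h₂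
  have h := congrArg (fun y : Matrix.SpecialLinearGroup (Fin 2) k =>
    (y : Matrix (Fin 2) (Fin 2) k).trace) h₂
  simp only [h₁, Matrix.SpecialLinearGroup.trace_conj,
    Matrix.SpecialLinearGroup.trace_iterate_map_frobenius] at h
  exact h.symm
end

section
/- Let V be an n-dimensional vector space over a field k and let H be a subgroup of GL(V). Suppose H contains unipotent elements u and v with rank(u − 1) = rank(v − 1) = n − 1, such that ker((u − 1)^d) ∩ ker((v − 1)^{n−d}) = 0 for every integer 0 < d < n. Then V is irreducible as an H-module: the only subspaces U ⊆ V with g(U) = U for all g ∈ H are U = 0 and U = V. -/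
open Module

theorem Submodule.le_ker_pow_finrank_of_isNilpotent {k V : Type*} [Field k] [AddCommGroup V]
    [Module k V] [FiniteDimensional k V] {f : V →ₗ[k] V} (hf : IsNilpotent f)
    {U : Submodule k V} (hU : ∀ x ∈ U, f x ∈ U) :
    U ≤ LinearMap.ker (f ^ finrank k U) := by
  intro x hx
  obtain ⟨m, hm⟩ := hf
  have h : (⟨x, hx⟩ : U) ∈ LinearMap.ker (f.restrict hU ^ m) := by
    rw [Module.End.pow_restrict, LinearMap.mem_ker]
    ext
    simp [LinearMap.restrict_apply, hm]
  have h' := Module.End.ker_pow_le_ker_pow_finrank (f.restrict hU) m h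
  rw [Module.End.pow_restrict, LinearMap.mem_ker] at h'
  simpa [LinearMap.restrict_apply] using congrArg Subtype.val h'

theorem Submodule.eq_bot_of_inf_ker_eq_bot_of_isNilpotent {k V : Type*} [Field k]
    [AddCommGroup V] [Module k V] {f : V →ₗ[k] V} (hf : IsNilpotent f)
    {U : Submodule k V} (hU : ∀ x ∈ U, f x ∈ U) (h : U ⊓ LinearMap.ker f = ⊥) : U = ⊥ := by
  obtain ⟨m, hm⟩ := hf
  have key : ∀ j : ℕ, ∀ x ∈ U, (f ^ j) x = 0 → x = 0 := by
    intro j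
    induction j with
    | zero => intro x _ hx; simpa using hx
    | succ j ih =>
      intro x hxU hx
      rw [pow_succ] at hx
      have hfx : f x = 0 := ih (f x) (hU x hxU) hx
      exact (Submodule.mem_bot k).1 (h ▸ Submodule.mem_inf.2 ⟨hxU, LinearMap.mem_ker.2 hfx⟩)
  exact (Submodule.eq_bot_iff U).2 fun x hx => key m x hx (by simp [hm])

/-- Let `V` be an `n`-dimensional vector space over a field `k` and let
`H ≤ GL(V)` be a subgroup containing unipotent elements `u, v` with
`rank (u - 1) = rank (v - 1) = n - 1` whose invariant complete flags are in opposite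
position: `ker ((u - 1) ^ d) ⊓ ker ((v - 1) ^ (n - d)) = 0` for all `0 < d < n`.
Then `V` is an irreducible `H`-module. -/
theorem stmt8 {k V : Type*} [Field k] [AddCommGroup V] [Module k V]
    [FiniteDimensional k V] {n : ℕ} (hV : finrank k V = n)
    (H : Subgroup (LinearMap.GeneralLinearGroup k V))
    (u v : LinearMap.GeneralLinearGroup k V) (hu : u ∈ H) (hv : v ∈ H)
    (huN : IsNilpotent ((u : V →ₗ[k] V) - 1))
    (hvN : IsNilpotent ((v : V →ₗ[k] V) - 1))
    (hur : finrank k (LinearMap.range ((u : V →ₗ[k] V) - 1)) = n - 1)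
    (hvr : finrank k (LinearMap.range ((v : V →ₗ[k] V) - 1)) = n - 1)
    (hopp : ∀ d : ℕ, 0 < d → d < n →
      LinearMap.ker (((u : V →ₗ[k] V) - 1) ^ d) ⊓
        LinearMap.ker (((v : V →ₗ[k] V) - 1) ^ (n - d)) = ⊥) :
    ∀ U : Submodule k V,
      (∀ g : LinearMap.GeneralLinearGroup k V, g ∈ H → U.map (g : V →ₗ[k] V) = U) →
      U = ⊥ ∨ U = ⊤ := by
  intro U hU
  have hinv : ∀ g ∈ H, ∀ x ∈ U, ((g : V →ₗ[k] V) - 1) x ∈ U := fun g hg x hx =>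
    U.sub_mem (hU g hg ▸ Submodule.mem_map_of_mem hx) hx
  by_contra! hne
  have hpos : 0 < finrank k U := Submodule.one_le_finrank_iff.2 hne.1
  have hlt : finrank k U < n := hV ▸ Submodule.finrank_lt hne.2
  refine hne.1 (Submodule.eq_bot_of_inf_ker_eq_bot_of_isNilpotent hvN (hinv v hv) ?_)
  rw [eq_bot_iff, ← hopp _ hpos hlt]
  refine inf_le_inf (Submodule.le_ker_pow_finrank_of_isNilpotent huN (hinv u hu)) fun x hx => ?_
  obtain ⟨j, hj⟩ := Nat.exists_eq_succ_of_ne_zero (Nat.sub_ne_zero_of_lt hlt)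
  rw [LinearMap.mem_ker] at hx ⊢
  rw [hj, pow_succ, Module.End.mul_apply, hx, map_zero]
end
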